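/- arXiv:2409.19857 — 2 statements merged into one kernel-verified Lean document; each statement's English description precedes it below -/
import Mathlib

section
/- If e and e' are exceptional classes in Λ with e ≠ e', then ⟨e, e'⟩ ≥ 0. -/
namespace ConicOrder

/-- The Picard lattice `Λ = ℤ⁸` of the blow-up of `ℙ²` at 7 general points,
with coordinates `(L, E₁, …, E₇)`. -/
abbrev Lam : Type := Fin 8 → ℤ

/-- The intersection form: `⟨L,L⟩ = 1`, `⟨Eᵢ,Eᵢ⟩ = −1`, distinct basis vectors orthogonal. -/
def form (x y : Lam) : ℤ := x 0 * y 0 - ∑ i : Fin 7, x i.succ * y i.succ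

/-- The class `L` of a line. -/
def Lv : Lam := fun j => if j = 0 then 1 else 0

/-- The exceptional basis classes `E₁, …, E₇` (indexed by `Fin 7`). -/
def Ev (i : Fin 7) : Lam := fun j => if j = i.succ then 1 else 0

/-- The canonical class `K = −3L + E₁ + ⋯ + E₇`. -/
def K : Lam := fun j => if j = 0 then -3 else 1

/-- The Geiser involution `σ(x) = ⟨x,K⟩·K − x`. -/
def σ (x : Lam) : Lam := form x K • K - x

/-- A class `e` is exceptional if `⟨e,e⟩ = −1` and `⟨e,K⟩ = −1`. -/
def IsExceptional (e : Lam) : Prop := form e e = -1 ∧ form e K = -1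

/-- The intersection form is negative definite on the orthogonal complement of `K`. -/
theorem form_self_neg_of_form_K_eq_zero (x : Lam) (hK : form x K = 0) (hx : x ≠ 0) :
    form x x < 0 := by
  by_contra! h
  have hsum : ∑ i : Fin 7, x i.succ = -3 * x 0 := by
    simp only [form, K, Fin.succ_ne_zero, if_true, if_false, mul_one] at hK
    linarith
  have hcs := sq_sum_le_card_mul_sum_sq (s := Finset.univ) (f := fun i : Fin 7 => x i.succ)
  rw [hsum] at hcs
  simp only [Finset.card_univ, Fintype.card_fin, Nat.cast_ofNat] at hcs
  simp only [form, ← sq] at h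
  have h0 : x 0 = 0 := by
    have : x 0 ^ 2 ≤ 0 := by nlinarith
    exact pow_eq_zero_iff two_ne_zero |>.mp (le_antisymm this (sq_nonneg _))
  have hsq : ∑ i : Fin 7, x i.succ ^ 2 = 0 := by
    refine le_antisymm ?_ (Finset.sum_nonneg fun i _ => sq_nonneg _)
    simpa [h0] using h
  rw [Finset.sum_eq_zero_iff_of_nonneg fun i _ => sq_nonneg _] at hsq
  refine hx (funext fun j => ?_)
  refine Fin.cases h0 (fun i => ?_) j
  exact pow_eq_zero_iff two_ne_zero |>.mp (hsq i (Finset.mem_univ i))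

theorem form_sub_left (x y z : Lam) : form (x - y) z = form x z - form y z := by
  simp only [form, Pi.sub_apply, sub_mul, Finset.sum_sub_distrib]
  ring

theorem form_comm (x y : Lam) : form x y = form y x := by
  simp only [form, mul_comm]

/-- distinct exceptional classes meet non-negatively. -/
theorem exceptional_pairing_nonneg (e e' : Lam)
    (he : IsExceptional e) (he' : IsExceptional e') (hne : e ≠ e') :
    0 ≤ form e e' := by
  have hK : form (e - e') K = 0 := by rw [form_sub_left, he.2, he'.2, sub_self]
  have hneg := form_self_neg_of_form_K_eq_zero (e - e') hK (sub_ne_zero.mpr hne)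
  rw [form_sub_left, form_comm e, form_comm e', form_sub_left, form_sub_left,
    he.1, he'.1, form_comm e' e] at hneg
  linarith

end ConicOrder
end

section
/- The quotient group ker(1 + σ)/im(1 − σ) is isomorphic to (ℤ/2ℤ)⁶, and it is generated by the images of the six elements eᵢ := Eᵢ − Eᵢ₊₁, i = 1, …, 6. (For the group G = ⟨σ⟩ ≅ ℤ/2ℤ acting on Λ = Pic(Y), this quotient is the group cohomology H¹(G, Pic(Y)).) -/
namespace ConicOrder

/-- `h = L − 3E₁`. -/
def hgen : Lam := Lv - (3 : ℤ) • Ev 0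

/-- `eᵢ = Eᵢ − Eᵢ₊₁` for `i = 1, …, 6` (here indexed by `Fin 6`, so `egen 0 = e₁`, …,
`egen 5 = e₆`). -/
def egen (i : Fin 6) : Lam := Ev i.castSucc - Ev i.succ

lemma form_add_left (a b y : Lam) : form (a + b) y = form a y + form b y := by
  simp only [form, Pi.add_apply, add_mul, Finset.sum_add_distrib]
  ring

/-- The Geiser involution as an additive group homomorphism. -/
def σL : Lam →+ Lam where
  toFun := σ
  map_zero' := by
    have h : form 0 K = 0 := by simp [form]
    simp [σ, h]
  map_add' a b := by
    simp only [σ, form_add_left, add_smul]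
    abel

/-- The kernel of the endomorphism `1 + σ` of `Λ`. -/
def kerOnePlusSigma : AddSubgroup Lam := (AddMonoidHom.id Lam + σL).ker

/-- The image of the endomorphism `1 − σ` of `Λ`. -/
def imOneMinusSigma : AddSubgroup Lam := (AddMonoidHom.id Lam - σL).range

lemma mem_kerOnePlusSigma {x : Lam} : x ∈ kerOnePlusSigma ↔ form x K = 0 := by
  have h : (AddMonoidHom.id Lam + σL) x = form x K • K := by
    change x + (form x K • K - x) = _
    abel
  rw [kerOnePlusSigma, AddMonoidHom.mem_ker, h]
  refine ⟨fun h0 => ?_, fun h0 => by rw [h0, zero_smul]⟩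
  simpa [K] using congrFun h0 1

lemma form_K (x : Lam) :
    form x K = -(3 * x 0 + x 1 + x 2 + x 3 + x 4 + x 5 + x 6 + x 7) := by
  simp [form, K, Fin.sum_univ_succ, Fin.succ_ne_zero]
  ring_nf

lemma egen_mem_kerOnePlusSigma (i : Fin 6) : egen i ∈ kerOnePlusSigma := by
  rw [mem_kerOnePlusSigma]
  revert i
  decide

/-- An element of `K^⊥` lies in `im(1 − σ)` exactly when its coordinates have the same parity. -/
lemma mem_imOneMinusSigma {x : Lam} (hx : form x K = 0) :
    x ∈ imOneMinusSigma ↔ ∀ j, (2 : ℤ) ∣ x j + x 0 := by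
  have hσ : ∀ y, (AddMonoidHom.id Lam - σL) y = (2 : ℤ) • y - form y K • K := by
    intro y
    change y - (form y K • K - y) = _
    rw [two_smul]
    abel
  constructor
  · rintro ⟨y, rfl⟩ j
    rw [hσ]
    by_cases hj : j = 0 <;> simp [K, hj] <;> omega
  · intro h
    have key : ∀ c : ℤ, (∀ j, (2 : ℤ) ∣ x j + c * K j) → x ∈ imOneMinusSigma := by
      intro c hc
      choose y hy using hc
      have hyK : form y K = c := by
        have e0 := hy 0
        have e1 := hy 1
        have e2 := hy 2
        have e3 := hy 3
        have e4 := hy 4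
        have e5 := hy 5
        have e6 := hy 6
        have e7 := hy 7
        simp [K] at e0 e1 e2 e3 e4 e5 e6 e7
        rw [form_K] at hx ⊢
        omega
      refine ⟨y, ?_⟩
      rw [hσ, hyK]
      ext j
      simp only [Pi.sub_apply, Pi.smul_apply, smul_eq_mul]
      linarith [hy j]
    refine key (x 0) fun j => ?_
    have := h j
    by_cases hj : j = 0 <;> simp [K, hj] <;> omega

/-- The homomorphism `ker(1 + σ) → (ℤ/2ℤ)⁶` with coordinates `∑_{j ≤ i} (x_j + x_0)`;
it sends the `eᵢ` to the standard basis. -/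
def parityHom : kerOnePlusSigma →+ (Fin 6 → ZMod 2) :=
  AddMonoidHom.mk'
    (fun x i => ((∑ j ∈ Finset.Iic i, (x.1 j.castSucc.succ + x.1 0) : ℤ) : ZMod 2)) <| by
    intro x y
    ext i
    simp only [AddSubgroup.coe_add, Pi.add_apply, ← Int.cast_add, ← Finset.sum_add_distrib]
    congr 1
    exact Finset.sum_congr rfl fun j _ => by ring

lemma parityHom_apply (x : kerOnePlusSigma) (i : Fin 6) :
    parityHom x i = ((∑ j ∈ Finset.Iic i, (x.1 j.castSucc.succ + x.1 0) : ℤ) : ZMod 2) := rfl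

lemma parityHom_egen (i : Fin 6) :
    parityHom ⟨egen i, egen_mem_kerOnePlusSigma i⟩ = Pi.single i 1 := by
  ext k
  rw [parityHom_apply]
  revert i k
  decide

lemma ker_parityHom : parityHom.ker = imOneMinusSigma.addSubgroupOf kerOnePlusSigma := by
  ext ⟨x, hx⟩
  rw [mem_kerOnePlusSigma] at hx
  rw [AddSubgroup.mem_addSubgroupOf, mem_imOneMinusSigma hx, AddMonoidHom.mem_ker, funext_iff]
  simp only [parityHom_apply, Pi.zero_apply, ZMod.intCast_zmod_eq_zero_iff_dvd, Nat.cast_ofNat]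
  constructor
  · intro h
    rw [form_K] at hx
    have s0 : Finset.Iic (0 : Fin 6) = {0} := by decide
    have s1 : Finset.Iic (1 : Fin 6) = {0, 1} := by decide
    have s2 : Finset.Iic (2 : Fin 6) = {0, 1, 2} := by decide
    have s3 : Finset.Iic (3 : Fin 6) = {0, 1, 2, 3} := by decide
    have s4 : Finset.Iic (4 : Fin 6) = {0, 1, 2, 3, 4} := by decide
    have s5 : Finset.Iic (5 : Fin 6) = {0, 1, 2, 3, 4, 5} := by decide
    simp [Fin.forall_fin_succ, s0, s1, s2, s3, s4, s5] at h
    intro j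
    fin_cases j <;> simp <;> omega
  · exact fun h i => Finset.dvd_sum fun j _ => h _

lemma parityHom_sum_egen (c : Fin 6 → ZMod 2) :
    parityHom (∑ i, (c i).val • (⟨egen i, egen_mem_kerOnePlusSigma i⟩ : kerOnePlusSigma)) = c := by
  ext k
  simp only [map_sum, map_nsmul, parityHom_egen, Finset.sum_apply, Pi.smul_apply]
  simp [Pi.single_apply]

/-- `ker(1 + σ)/im(1 − σ) ≅ (ℤ/2ℤ)⁶`, generated by the images of the six
elements `eᵢ = Eᵢ − Eᵢ₊₁` (this quotient is `H¹(G, Pic Y)` for `G = ⟨σ⟩`). -/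
theorem ker_mod_im_iso_and_generators :
    Nonempty ((kerOnePlusSigma ⧸ imOneMinusSigma.addSubgroupOf kerOnePlusSigma) ≃+
        (Fin 6 → ZMod 2)) ∧
    AddSubgroup.closure
        {q : kerOnePlusSigma ⧸ imOneMinusSigma.addSubgroupOf kerOnePlusSigma |
          ∃ (i : Fin 6) (h : egen i ∈ kerOnePlusSigma),
            q = QuotientAddGroup.mk (⟨egen i, h⟩ : kerOnePlusSigma)} = ⊤ := by
  refine ⟨⟨(QuotientAddGroup.quotientAddEquivOfEq ker_parityHom.symm).trans
    (QuotientAddGroup.quotientKerEquivOfSurjective parityHom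
      fun c => ⟨_, parityHom_sum_egen c⟩)⟩, ?_⟩
  rw [eq_top_iff]
  rintro q -
  induction q using QuotientAddGroup.induction_on with
  | H x =>
    have hx : (QuotientAddGroup.mk x :
        kerOnePlusSigma ⧸ imOneMinusSigma.addSubgroupOf kerOnePlusSigma) =
        QuotientAddGroup.mk' _
          (∑ i, (parityHom x i).val •
            (⟨egen i, egen_mem_kerOnePlusSigma i⟩ : kerOnePlusSigma)) := by
      rw [QuotientAddGroup.mk'_apply, QuotientAddGroup.eq, ← ker_parityHom,
        AddMonoidHom.mem_ker, map_add, map_neg, parityHom_sum_egen, neg_add_cancel]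
    rw [hx, map_sum]
    refine AddSubgroup.sum_mem _ fun i _ => ?_
    rw [map_nsmul]
    refine AddSubgroup.nsmul_mem _ (AddSubgroup.subset_closure ?_) _
    exact ⟨i, egen_mem_kerOnePlusSigma i, rfl⟩

end ConicOrder
end
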